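/- Let 1 ≤ m ≤ N, p > 1 with p ≠ m, and write ξ = (η, τ) ∈ ℝ^m × ℝ^{N-m}. For every C¹ function u with compact support in (ℝ^m \ {0}) × ℝ^{N-m}, and every β ∈ ℝ, (|m+β|/p)^p ∫ |u(η,τ)|^p |η|^β dη dτ ≤ ∫ |∇u(η,τ)|^p |η|^{p+β} dη dτ. -/

import Mathlib

open Real MeasureTheory

/-- Algebraic Young step. -/
theorem hardy_young (p c a b r β : ℝ) (hp : 1 < p) (hc : 0 ≤ c) (ha : 0 ≤ a) (hb : 0 ≤ b)
    (hr : 0 < r) :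
    c ^ (p - 1) * (p * (a ^ (p - 1) * b * r * r ^ β)) ≤
      (p - 1) * c ^ p * (a ^ p * r ^ β) + b ^ p * r ^ (p + β) := by
  have hpq := Real.HolderConjugate.conjExponent hp
  have hp0 : 0 < p := by linarith
  have hp1 : 0 < p - 1 := by linarith
  have h := Real.young_inequality_of_nonneg (a := b * r) (b := (c * a) ^ (p - 1))
    (by positivity) (by positivity) hpq
  have e : ((c * a) ^ (p - 1)) ^ (Real.conjExponent p) = (c * a) ^ p := by
    rw [← Real.rpow_mul (by positivity)]
    congr 1
    unfold Real.conjExponent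
    field_simp
  rw [e, Real.mul_rpow hb hr.le, Real.mul_rpow hc ha, Real.mul_rpow hc ha] at h
  have e2 : c ^ p * a ^ p / Real.conjExponent p = (p - 1) * (c ^ p * a ^ p) / p := by
    unfold Real.conjExponent
    field_simp
  rw [e2, ← add_div, le_div_iff₀ hp0] at h
  rw [Real.rpow_add hr]
  have h3 := mul_le_mul_of_nonneg_right h (Real.rpow_nonneg hr.le β)
  nlinarith [h3]

theorem stmt7 (N m : ℕ) (hm1 : 1 ≤ m) (hmN : m ≤ N) (p β : ℝ) (hp : 1 < p)
    (hpm : p ≠ (m : ℝ))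
    (u : EuclideanSpace ℝ (Fin N) → ℝ) (hu : ContDiff ℝ 1 u) (hcs : HasCompactSupport u)
    (hsupp : ∀ ξ ∈ tsupport u, ∃ i : Fin m, ξ (Fin.castLE hmN i) ≠ 0) :
    (|(m : ℝ) + β| / p) ^ p *
        ∫ ξ : EuclideanSpace ℝ (Fin N),
          |u ξ| ^ p * Real.sqrt (∑ i : Fin m, ξ (Fin.castLE hmN i) ^ 2) ^ β ≤
      ∫ ξ : EuclideanSpace ℝ (Fin N),
        ‖gradient u ξ‖ ^ p * Real.sqrt (∑ i : Fin m, ξ (Fin.castLE hmN i) ^ 2) ^ (p + β) := by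
  have hp0 : 0 < p := by linarith
  set S : EuclideanSpace ℝ (Fin N) → ℝ := fun ξ => ∑ i : Fin m, ξ (Fin.castLE hmN i) ^ 2 with hS
  have hS0 : ∀ x, 0 ≤ S x := fun x => Finset.sum_nonneg fun i _ => sq_nonneg _
  have hSpos : ∀ x ∈ tsupport u, 0 < S x := by
    intro x hx
    obtain ⟨i, hi⟩ := hsupp x hx
    exact Finset.sum_pos' (fun i _ => sq_nonneg _) ⟨i, Finset.mem_univ _, by positivity⟩
  let L : Fin m → EuclideanSpace ℝ (Fin N) →L[ℝ] ℝ := fun i =>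
    EuclideanSpace.proj (Fin.castLE hmN i)
  let e : Fin m → EuclideanSpace ℝ (Fin N) := fun i =>
    EuclideanSpace.single (Fin.castLE hmN i) (1 : ℝ)
  have hL : ∀ i x, L i x = x (Fin.castLE hmN i) := fun i x => rfl
  have hLe : ∀ i j, L i (e j) = if i = j then 1 else 0 := by
    intro i j
    simp [hL, e, Pi.single_apply, Fin.ext_iff]
  have hSL : ∀ x, S x = ∑ i, L i x ^ 2 := fun x => rfl
  have hSsm : ContDiff ℝ 1 S := by
    have : S = fun x => ∑ i, L i x ^ 2 := rfl
    rw [this]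
    exact ContDiff.sum fun i _ => ((L i).contDiff).pow 2
  have hSd : ∀ x, HasFDerivAt S (∑ i, (2 * L i x) • L i) x := by
    intro x
    have : S = fun x => ∑ i, L i x ^ 2 := rfl
    rw [this]
    refine HasFDerivAt.fun_sum fun i _ => ?_
    have h := (hasDerivAt_pow 2 (L i x)).comp_hasFDerivAt x ((L i).hasFDerivAt (x := x))
    have h2 : ((2 : ℕ) : ℝ) * L i x ^ (2 - 1) = 2 * L i x := by norm_num
    rw [h2] at h
    exact h
  let P : EuclideanSpace ℝ (Fin N) → EuclideanSpace ℝ (Fin N) := fun x => ∑ i, L i x • e i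
  have hLP : ∀ i x, L i (P x) = L i x := by
    intro i x
    simp [P, map_sum, hLe]
  have hPn : ∀ x, ‖P x‖ = √(S x) := by
    intro x
    have ho : Orthonormal ℝ e :=
      (EuclideanSpace.orthonormal_single (𝕜 := ℝ) (ι := Fin N)).comp _
        (Fin.castLE_injective hmN)
    rw [norm_eq_sqrt_real_inner]
    congr 1
    simp only [P]
    rw [ho.inner_sum]
    simp [hSL, sq]
  have hgr : ∀ x, ‖gradient u x‖ = ‖fderiv ℝ u x‖ := by
    intro x
    simp [gradient]
  -- rewriting of the weights
  have hsq : ∀ x (γ : ℝ), √(S x) ^ γ = S x ^ (γ / 2) := by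
    intro x γ
    rw [Real.sqrt_eq_rpow, ← Real.rpow_mul (hS0 x)]
    congr 1; ring
  set v : EuclideanSpace ℝ (Fin N) → ℝ := fun x => |u x| ^ p * √(S x) ^ β with hv
  set R : EuclideanSpace ℝ (Fin N) → ℝ := fun x => ‖gradient u x‖ ^ p * √(S x) ^ (p + β) with hR
  have hv' : v = fun x => |u x| ^ p * S x ^ (β / 2) := by
    funext x; simp only [hv, hsq]
  have hR' : R = fun x => ‖fderiv ℝ u x‖ ^ p * S x ^ ((p + β) / 2) := by
    funext x; simp only [hR, hsq, hgr]
  have hv0 : ∀ x ∉ tsupport u, v =ᶠ[nhds x] 0 := by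
    intro x hx
    filter_upwards [notMem_tsupport_iff_eventuallyEq.1 hx] with y hy
    simp [hv, hy, Real.zero_rpow hp0.ne']
  have hR0 : ∀ x ∉ tsupport u, R =ᶠ[nhds x] 0 := by
    intro x hx
    filter_upwards [(isClosed_tsupport u).isOpen_compl.mem_nhds hx] with y hy
    have : fderiv ℝ u y = 0 := fderiv_of_notMem_tsupport ℝ hy
    simp [hR', this, Real.zero_rpow hp0.ne']
  have hvC : ContDiff ℝ 1 v := by
    rw [contDiff_iff_contDiffAt]
    intro x
    by_cases hx : x ∈ tsupport u
    · rw [hv']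
      exact (hu.norm_rpow hp).contDiffAt.mul
        (hSsm.contDiffAt.rpow_const_of_ne (hSpos x hx).ne')
    · exact (contDiffAt_const (c := (0:ℝ))).congr_of_eventuallyEq (hv0 x hx)
  have hRC : Continuous R := by
    rw [continuous_iff_continuousAt]
    intro x
    by_cases hx : x ∈ tsupport u
    · rw [hR']
      refine ContinuousAt.mul ?_ ?_
      · exact ((hu.continuous_fderiv one_ne_zero).norm.rpow_const
          (fun _ => Or.inr hp0.le)).continuousAt
      · exact hSsm.continuous.continuousAt.rpow_const (Or.inl (hSpos x hx).ne')
    · exact (continuousAt_const (y := (0:ℝ))).congr (hR0 x hx).symm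
  have hvcs : HasCompactSupport v :=
    HasCompactSupport.intro hcs fun x hx => (hv0 x hx).eq_of_nhds
  have hRcs : HasCompactSupport R :=
    HasCompactSupport.intro hcs fun x hx => (hR0 x hx).eq_of_nhds
  have hvI : Integrable v := hvC.continuous.integrable_of_hasCompactSupport hvcs
  have hRI : Integrable R := hRC.integrable_of_hasCompactSupport hRcs
  have hfv : ∀ i, Continuous fun x => fderiv ℝ v x (e i) := fun i =>
    (hvC.continuous_fderiv one_ne_zero).clm_apply continuous_const
  have hfI : ∀ i, Integrable fun x => L i x * fderiv ℝ v x (e i) := by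
    intro i
    refine ((L i).continuous.mul (hfv i)).integrable_of_hasCompactSupport ?_
    refine HasCompactSupport.intro hcs fun x hx => ?_
    have : fderiv ℝ v x = 0 := by rw [(hv0 x hx).fderiv_eq]; simp
    simp [this]
  have hibp : ∀ i, ∫ x, L i x * fderiv ℝ v x (e i) = - ∫ x, v x := by
    intro i
    have h1 : ∀ x, fderiv ℝ (fun y => L i y) x (e i) = 1 := by
      intro x
      have : fderiv ℝ (fun y => L i y) x = L i := (L i).fderiv
      rw [this, hLe]; simp
    have := integral_mul_fderiv_eq_neg_fderiv_mul_of_integrable (μ := volume)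
      (f := fun y => L i y) (g := v) (v := e i) (by simpa only [h1, one_mul] using hvI) (hfI i)
      (((L i).continuous.mul hvC.continuous).integrable_of_hasCompactSupport hvcs.mul_left)
      (fun x _ => (L i).differentiableAt)
      (fun x _ => hvC.differentiable one_ne_zero x)
    rw [this]
    simp only [h1, one_mul]
  let G : EuclideanSpace ℝ (Fin N) → ℝ := fun x => ∑ i, L i x * fderiv ℝ v x (e i)
  have hGI : Integrable G := integrable_finsetSum _ fun i _ => hfI i
  have hGint : ∫ x, G x = -(m * ∫ x, v x) := by
    simp only [G]
    rw [integral_finsetSum _ fun i _ => hfI i]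
    simp [hibp]
  have hGP : ∀ x, G x = fderiv ℝ v x (P x) := by
    intro x
    simp [G, P, map_sum]
  set c : ℝ := |(m : ℝ) + β| / p with hc
  have hc0 : 0 ≤ c := by positivity
  have hpt : ∀ x, c ^ (p - 1) * |β * v x - G x| ≤ (p - 1) * c ^ p * v x + R x := by
    intro x
    by_cases hx : x ∈ tsupport u
    · have hSx := hSpos x hx
      have hd1 : HasFDerivAt (fun y => |u y| ^ p)
          ((p * |u x| ^ (p - 2) * u x) • fderiv ℝ u x) x :=
        (hasDerivAt_abs_rpow (u x) hp).comp_hasFDerivAt x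
          (hu.differentiable one_ne_zero x).hasFDerivAt
      have hd2 := (hSd x).rpow_const (p := β / 2) (Or.inl hSx.ne')
      have hd := hd1.mul hd2
      have hfd : fderiv ℝ v x (P x) = β * v x +
          p * |u x| ^ (p - 2) * u x * fderiv ℝ u x (P x) * S x ^ (β / 2) := by
        rw [hv']
        refine (congrArg (fun T : EuclideanSpace ℝ (Fin N) →L[ℝ] ℝ => T (P x)) hd.fderiv).trans ?_
        have hs : (∑ i, (2 * L i x) • L i) (P x) = 2 * S x := by
          simp [hLP, hSL, Finset.mul_sum, sq, mul_assoc]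
        have hs2 : S x ^ (β / 2) = S x ^ (β / 2 - 1) * S x := by
          rw [Real.rpow_sub_one hSx.ne']; field_simp
        simp only [ContinuousLinearMap.add_apply, ContinuousLinearMap.smul_apply, hs, smul_eq_mul]
        rw [hs2]
        ring
      have hab : |β * v x - G x| ≤
          p * (|u x| ^ (p - 1) * ‖gradient u x‖ * √(S x) * √(S x) ^ β) := by
        rw [hGP, hfd, sub_add_cancel_left, abs_neg, abs_mul, abs_mul, abs_mul, abs_mul,
          abs_of_pos hp0, abs_of_nonneg (Real.rpow_nonneg (abs_nonneg (u x)) (p - 2)),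
          abs_of_pos (Real.rpow_pos_of_pos hSx _), ← hsq]
        have hu1 : |u x| ^ (p - 2) * |u x| = |u x| ^ (p - 1) := by
          by_cases h0 : u x = 0
          · simp [h0, Real.zero_rpow (by linarith : p - 1 ≠ 0)]
          · rw [← Real.rpow_add_one (abs_pos.2 h0).ne']
            congr 1; ring
        have hop : |fderiv ℝ u x (P x)| ≤ ‖gradient u x‖ * √(S x) := by
          rw [hgr, ← hPn]
          exact (fderiv ℝ u x).le_opNorm _
        calc p * |u x| ^ (p - 2) * |u x| * |fderiv ℝ u x (P x)| * √(S x) ^ β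
            = p * |u x| ^ (p - 1) * |fderiv ℝ u x (P x)| * √(S x) ^ β := by
              rw [← hu1]; ring
          _ ≤ p * |u x| ^ (p - 1) * (‖gradient u x‖ * √(S x)) * √(S x) ^ β := by gcongr
          _ = _ := by ring
      refine (mul_le_mul_of_nonneg_left hab (Real.rpow_nonneg hc0 _)).trans ?_
      exact hardy_young p c _ _ _ β hp hc0 (abs_nonneg _) (norm_nonneg _) (Real.sqrt_pos.2 hSx)
    · have h1 : v x = 0 := (hv0 x hx).eq_of_nhds
      have h2 : R x = 0 := (hR0 x hx).eq_of_nhds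
      have h3 : fderiv ℝ v x = 0 := by rw [(hv0 x hx).fderiv_eq]; simp
      simp [h1, h2, hGP, h3]
  have hint := integral_mono (((hvI.const_mul β).sub hGI).abs.const_mul (c ^ (p - 1)))
    ((hvI.const_mul ((p - 1) * c ^ p)).add hRI) hpt
  have hlow : p * c * ∫ x, v x ≤ ∫ x, |β * v x - G x| := by
    have hvn : 0 ≤ ∫ x, v x := integral_nonneg fun x => by
      simp only [hv]; positivity
    have h1 : ∫ x, (β * v x - G x) = (m + β) * ∫ x, v x := by
      rw [integral_sub (hvI.const_mul β) hGI, hGint, integral_const_mul]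
      ring
    have h2 := abs_integral_le_integral_abs (μ := volume) (f := fun x => β * v x - G x)
    rw [h1, abs_mul, abs_of_nonneg hvn] at h2
    have : p * c = |(m : ℝ) + β| := by rw [hc]; field_simp
    rwa [this]
  have hcp : c ^ (p - 1) * c = c ^ p := by
    by_cases h0 : c = 0
    · rw [h0]; simp [Real.zero_rpow hp0.ne']
    · rw [← Real.rpow_add_one h0]; congr 1; ring
  have hrhs : ∫ x, ((p - 1) * c ^ p * v x + R x) = (p - 1) * c ^ p * (∫ x, v x) + ∫ x, R x := by
    rw [integral_add (hvI.const_mul _) hRI, integral_const_mul]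
  have hlhs : ∫ x, c ^ (p - 1) * |β * v x - G x| = c ^ (p - 1) * ∫ x, |β * v x - G x| :=
    integral_const_mul _ _
  have hfin : c ^ (p - 1) * (∫ x, |β * v x - G x|) ≤
      (p - 1) * c ^ p * (∫ x, v x) + ∫ x, R x := by
    rw [← hrhs, ← hlhs]; exact hint
  have hl2 := mul_le_mul_of_nonneg_left hlow (Real.rpow_nonneg hc0 (p - 1))
  have hl3 : c ^ (p - 1) * (p * c * ∫ x, v x) = p * (c ^ p * ∫ x, v x) := by
    rw [← hcp]; ring
  rw [hl3] at hl2
  linarith
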